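/- Fix integers n₁ ≥ n₂ ≥ 2 and set n = n₁ + n₂; write y = (y₁, y₂) ∈ ℝⁿ = ℝ^{n₁} × ℝ^{n₂}. Let F be a Minkowski norm on ℝⁿ that is invariant under SO(n₁) × SO(n₂), i.e., F(g₁y₁, g₂y₂) = F(y₁, y₂) for all rotations g₁ ∈ SO(n₁), g₂ ∈ SO(n₂) and all y. Suppose in addition that there exist nonzero vectors v₁ ∈ ℝ^{n₁} × {0} and v₂ ∈ {0} × ℝ^{n₂} such that for all real t, w₁, w₂: F((w₁ cos t − w₂ sin t)·v₁ + (w₁ sin t + w₂ cos t)·v₂) = F(w₁·v₁ + w₂·v₂). Then there exist constants a > 0 and b > 0 such that F(y)² = a‖y₁‖² + b‖y₂‖² for all y ∈ ℝⁿ; in particular F is a Euclidean norm. -/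

import Mathlib

open Matrix

/-- A Minkowski norm on a real normed vector space `E`: a continuous nonnegative function,
smooth away from the origin, positively homogeneous of degree one, and strongly convex in
the sense that for every `y ≠ 0` the Hessian `g_y(v, v) = (1/2) D²(F²)(y)[v, v]` is
positive definite. -/
def IsMinkowskiNorm {E : Type*} [NormedAddCommGroup E] [NormedSpace ℝ E] (F : E → ℝ) : Prop :=
  Continuous F ∧ (∀ y, 0 ≤ F y) ∧
    ContDiffOn ℝ (⊤ : ℕ∞) F {(0 : E)}ᶜ ∧
    (∀ (c : ℝ) (y : E), 0 < c → F (c • y) = c * F y) ∧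
    ∀ y : E, y ≠ 0 → ∀ v : E, v ≠ 0 →
      0 < (1 / 2 : ℝ) * fderiv ℝ (fun z : E => fderiv ℝ (fun w : E => F w ^ 2) z v) y v

/-- The Householder reflection in the hyperplane orthogonal to `u`. -/
noncomputable def householder {m : ℕ} (u : Fin m → ℝ) : Matrix (Fin m) (Fin m) ℝ :=
  1 - (2 / (u ⬝ᵥ u)) • vecMulVec u u

theorem householder_mulVec {m : ℕ} (u x : Fin m → ℝ) :
    householder u *ᵥ x = x - (2 / (u ⬝ᵥ u) * (u ⬝ᵥ x)) • u := by
  ext i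
  simp [householder, sub_mulVec, smul_mulVec, vecMulVec_mulVec]
  ring

theorem householder_transpose {m : ℕ} (u : Fin m → ℝ) : (householder u)ᵀ = householder u := by
  simp [householder, transpose_vecMulVec]

theorem householder_mul_self {m : ℕ} {u : Fin m → ℝ} (hu : u ≠ 0) :
    householder u * householder u = 1 := by
  have h : u ⬝ᵥ u ≠ 0 := by simpa using hu
  simp only [householder, mul_sub, sub_mul, mul_one, one_mul, smul_mul_smul_comm,
    vecMulVec_mul_vecMulVec]
  ext i j
  simp [vecMulVec_apply]
  field_simp
  ring

theorem householder_det {m : ℕ} {u : Fin m → ℝ} (hu : u ≠ 0) : (householder u).det = -1 := by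
  have h : u ⬝ᵥ u ≠ 0 := by simpa using hu
  have : householder u =
      1 + replicateCol Unit (-(2 / (u ⬝ᵥ u)) • u) * replicateRow Unit u := by
    ext i j
    simp [householder, vecMulVec_apply, Matrix.mul_apply, sub_eq_add_neg, mul_assoc]
  rw [this, det_one_add_replicateCol_mul_replicateRow, dotProduct_smul, smul_eq_mul]
  field_simp
  ring

/-- The group `SO(m)`, `m ≥ 2`, acts transitively on each sphere centred at the origin. -/
theorem exists_rotation_mulVec_eq {m : ℕ} (hm : 2 ≤ m) {x y : Fin m → ℝ}
    (h : x ⬝ᵥ x = y ⬝ᵥ y) :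
    ∃ g : Matrix (Fin m) (Fin m) ℝ, gᵀ * g = 1 ∧ g.det = 1 ∧ g *ᵥ x = y := by
  by_cases hxy : x = y
  · exact ⟨1, by simp, by simp, by simp [hxy]⟩
  have hd : x - y ≠ 0 := sub_ne_zero.mpr hxy
  have hd' : (x - y) ⬝ᵥ (x - y) ≠ 0 := dotProduct_self_eq_zero.not.mpr hd
  have : Nontrivial (Fin m) := Fin.nontrivial_iff_two_le.mpr hm
  obtain ⟨u, hu, huy⟩ := exists_ne_zero_dotProduct_eq_zero y
  have hrefl : householder (x - y) *ᵥ x = y := by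
    have h2 : 2 / ((x - y) ⬝ᵥ (x - y)) * ((x - y) ⬝ᵥ x) = 1 := by
      have : (x - y) ⬝ᵥ (x - y) = 2 * ((x - y) ⬝ᵥ x) := by
        simp only [sub_dotProduct, dotProduct_sub, dotProduct_comm x y]
        linarith
      field_simp
      linarith
    rw [householder_mulVec, h2]
    simp
  refine ⟨householder u * householder (x - y), ?_, ?_, ?_⟩
  · rw [transpose_mul, householder_transpose, householder_transpose, Matrix.mul_assoc,
      ← Matrix.mul_assoc (householder u), householder_mul_self hu, Matrix.one_mul,
      householder_mul_self hd]
  · rw [det_mul, householder_det hu, householder_det hd]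
    norm_num
  · rw [← mulVec_mulVec, hrefl, householder_mulVec, huy]
    simp

theorem IsMinkowskiNorm.map_zero {E : Type*} [NormedAddCommGroup E] [NormedSpace ℝ E]
    {F : E → ℝ} (hF : IsMinkowskiNorm F) : F 0 = 0 := by
  have := hF.2.2.2.1 2 0 two_pos
  rw [smul_zero] at this
  linarith

theorem IsMinkowskiNorm.map_smul_of_nonneg {E : Type*} [NormedAddCommGroup E]
    [NormedSpace ℝ E] {F : E → ℝ} (hF : IsMinkowskiNorm F) {c : ℝ} (hc : 0 ≤ c) (y : E) :
    F (c • y) = c * F y := by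
  rcases hc.eq_or_lt with rfl | hc
  · simp [hF.map_zero]
  · exact hF.2.2.2.1 c y hc

theorem IsMinkowskiNorm.pos {E : Type*} [NormedAddCommGroup E] [NormedSpace ℝ E]
    {F : E → ℝ} (hF : IsMinkowskiNorm F) {y : E} (hy : y ≠ 0) : 0 < F y := by
  refine (hF.2.1 y).lt_of_ne' fun h0 => ?_
  have hpos := hF.2.2.2.2 y hy y hy
  set G : E → ℝ := fun z => fderiv ℝ (fun w : E => F w ^ 2) z y with hG
  have hGz : ∀ c : ℝ, 0 ≤ c → G (c • y) = 0 := fun c hc => by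
    have hmin : IsLocalMin (fun w : E => F w ^ 2) (c • y) :=
      Filter.Eventually.of_forall fun w => by
        simpa [hF.map_smul_of_nonneg hc, h0] using sq_nonneg (F w)
    simp [hG, hmin.fderiv_eq_zero]
  have hzero : fderiv ℝ G y y = 0 := by
    by_cases hd : DifferentiableAt ℝ G y
    · have hline : HasDerivAt (fun c : ℝ => c • y) y 1 := by
        simpa using (hasDerivAt_id (1 : ℝ)).smul_const y
      have hd1 : HasFDerivAt G (fderiv ℝ G y) ((1 : ℝ) • y) := by
        simpa using hd.hasFDerivAt
      have h1 := hd1.comp_hasDerivAt (1 : ℝ) hline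
      have h2 : HasDerivAt (G ∘ fun c : ℝ => c • y) 0 1 :=
        (hasDerivAt_const (1 : ℝ) (0 : ℝ)).congr_of_eventuallyEq <| by
          filter_upwards [lt_mem_nhds (zero_lt_one (α := ℝ))] with c hc
          exact hGz c hc.le
      exact h1.unique h2
    · simp [fderiv_zero_of_not_differentiableAt hd]
  rw [hzero] at hpos
  simp at hpos

/-- With `n₁ ≥ n₂ ≥ 2`, let `F` be a Minkowski norm on
`ℝⁿ = ℝ^{n₁} × ℝ^{n₂}` invariant under `SO(n₁) × SO(n₂)`, and suppose that there are
nonzero vectors `v₁ ∈ ℝ^{n₁} × 0`, `v₂ ∈ 0 × ℝ^{n₂}` such that `F` is invariant under the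
rotations of the plane spanned by `v₁` and `v₂`. Then there are constants `a, b > 0` with
`F(y)² = a ‖y₁‖² + b ‖y₂‖²`; in particular `F` is a Euclidean norm. -/
theorem statement19 (n₁ n₂ : ℕ) (h21 : n₂ ≤ n₁) (h2 : 2 ≤ n₂)
    (F : (Fin n₁ → ℝ) × (Fin n₂ → ℝ) → ℝ)
    (hMink : IsMinkowskiNorm F)
    (hinv : ∀ (g₁ : Matrix (Fin n₁) (Fin n₁) ℝ) (g₂ : Matrix (Fin n₂) (Fin n₂) ℝ),
      g₁ᵀ * g₁ = 1 → g₁.det = 1 → g₂ᵀ * g₂ = 1 → g₂.det = 1 →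
      ∀ y : (Fin n₁ → ℝ) × (Fin n₂ → ℝ), F (g₁.mulVec y.1, g₂.mulVec y.2) = F y)
    (v₁ : Fin n₁ → ℝ) (v₂ : Fin n₂ → ℝ) (hv₁ : v₁ ≠ 0) (hv₂ : v₂ ≠ 0)
    (hrot : ∀ t w₁ w₂ : ℝ,
      F ((w₁ * Real.cos t - w₂ * Real.sin t) • v₁, (w₁ * Real.sin t + w₂ * Real.cos t) • v₂) =
        F (w₁ • v₁, w₂ • v₂)) :
    ∃ a b : ℝ, 0 < a ∧ 0 < b ∧
      ∀ y : (Fin n₁ → ℝ) × (Fin n₂ → ℝ),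
        F y ^ 2 = a * (∑ i, y.1 i ^ 2) + b * (∑ i, y.2 i ^ 2) := by
  have hr : ∀ a b : ℝ, F (a • v₁, b • v₂) ^ 2 = (a ^ 2 + b ^ 2) * F (v₁, 0) ^ 2 := by
    intro a b
    have h := hrot (Complex.arg ⟨a, b⟩) ‖(⟨a, b⟩ : ℂ)‖ 0
    have hre : ‖(⟨a, b⟩ : ℂ)‖ * Real.cos (Complex.arg ⟨a, b⟩) = a :=
      Complex.norm_mul_cos_arg _
    have him : ‖(⟨a, b⟩ : ℂ)‖ * Real.sin (Complex.arg ⟨a, b⟩) = b :=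
      Complex.norm_mul_sin_arg _
    have hs : (‖(⟨a, b⟩ : ℂ)‖ • v₁, (0 : ℝ) • v₂) = ‖(⟨a, b⟩ : ℂ)‖ • (v₁, (0 : Fin n₂ → ℝ)) := by
      simp
    rw [hre, him, hs, hMink.map_smul_of_nonneg (norm_nonneg _)] at h
    simp only [zero_mul, sub_zero, add_zero] at h
    rw [h, mul_pow, Complex.sq_norm, Complex.normSq_apply]
    ring
  have hc : 0 < F (v₁, 0) := hMink.pos (by simpa using hv₁)
  have hsq : ∀ {m : ℕ} (x : Fin m → ℝ), x ⬝ᵥ x = ∑ i, x i ^ 2 := fun x => by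
    simp [dotProduct, sq]
  have hnn : ∀ {m : ℕ} (x : Fin m → ℝ), 0 ≤ x ⬝ᵥ x := fun x => by
    rw [hsq]; positivity
  have hp : ∀ {m : ℕ} {x : Fin m → ℝ}, x ≠ 0 → 0 < x ⬝ᵥ x := fun {m x} hx =>
    (hnn x).lt_of_ne' (by simpa using hx)
  have hp₁ := hp hv₁
  have hp₂ := hp hv₂
  refine ⟨F (v₁, 0) ^ 2 / (v₁ ⬝ᵥ v₁), F (v₁, 0) ^ 2 / (v₂ ⬝ᵥ v₂), by positivity,
    by positivity, fun y => ?_⟩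
  have hscale : ∀ {m : ℕ} {v : Fin m → ℝ} (x : Fin m → ℝ), 0 < v ⬝ᵥ v →
      (√((x ⬝ᵥ x) / (v ⬝ᵥ v)) • v) ⬝ᵥ (√((x ⬝ᵥ x) / (v ⬝ᵥ v)) • v) = x ⬝ᵥ x := by
    intro m v x hv
    rw [smul_dotProduct, dotProduct_smul, smul_eq_mul, smul_eq_mul, ← mul_assoc,
      Real.mul_self_sqrt (div_nonneg (hnn x) hv.le), div_mul_cancel₀ _ hv.ne']
  obtain ⟨g₁, ho₁, hd₁, he₁⟩ := exists_rotation_mulVec_eq (h2.trans h21) (hscale y.1 hp₁)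
  obtain ⟨g₂, ho₂, hd₂, he₂⟩ := exists_rotation_mulVec_eq h2 (hscale y.2 hp₂)
  have h := hinv g₁ g₂ ho₁ hd₁ ho₂ hd₂
    (√((y.1 ⬝ᵥ y.1) / (v₁ ⬝ᵥ v₁)) • v₁, √((y.2 ⬝ᵥ y.2) / (v₂ ⬝ᵥ v₂)) • v₂)
  rw [he₁, he₂] at h
  rw [← hsq, ← hsq, show F y = F (y.1, y.2) from rfl, h, hr,
    Real.sq_sqrt (div_nonneg (hnn _) hp₁.le), Real.sq_sqrt (div_nonneg (hnn _) hp₂.le)]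
  ring
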